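/- For all ε ∈ {±1}, m ∈ ℤ, and a,b ∈ ℂ with Re(a) > 0 and Re(b) > 0: ℬ_{ε,m}(a,b) = [(4+3a+5b+2ab+2b²−m²)/(b(1+b))] · ℬ_{ε,m}(a,b+2) − [((2+a+b−m)(2+a+b+m))/(b(1+b))] · ℬ_{ε,m}(a,b+4). -/

import Mathlib

open MeasureTheory

/-- The beta-type function
`ℬ_{ε,m}(a,b) = ∫_0^∞ x^{a−1} (1+x²)^{−(a+b)/2}
  [((1+ix)/√(1+x²))^{−m} + ε((1−ix)/√(1+x²))^{−m}] dx`. -/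
noncomputable def Bfun (ε : ℝ) (m : ℤ) (a b : ℂ) : ℂ :=
  ∫ x in Set.Ioi (0 : ℝ),
    (x : ℂ) ^ (a - 1) * (((1 + x ^ 2 : ℝ)) : ℂ) ^ (-(a + b) / 2) *
      (((1 + (x : ℂ) * Complex.I) / ((Real.sqrt (1 + x ^ 2) : ℝ) : ℂ)) ^ (-m) +
        (ε : ℂ) * ((1 - (x : ℂ) * Complex.I) / ((Real.sqrt (1 + x ^ 2) : ℝ) : ℂ)) ^ (-m))

/-- The point `(1 + ix) / √(1 + x²)` of the unit circle. -/
noncomputable def unitPoint (x : ℝ) : ℂ :=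
  (1 + (x : ℂ) * Complex.I) / ((Real.sqrt (1 + x ^ 2) : ℝ) : ℂ)

/-- One of the two summands of the integrand of `Bfun`. -/
noncomputable def betaKernel (m : ℤ) (a b : ℂ) (x : ℝ) : ℂ :=
  (x : ℂ) ^ (a - 1) * (((1 + x ^ 2 : ℝ)) : ℂ) ^ (-(a + b) / 2) * unitPoint x ^ (-m)

/-- A primitive of the combination of kernels occurring in the recursion formula. -/
noncomputable def betaPrimitive (m : ℤ) (a b : ℂ) (x : ℝ) : ℂ :=
  (x : ℂ) ^ a * (((1 + x ^ 2 : ℝ)) : ℂ) ^ (-(a + b) / 2 - 1) *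
    ((a + 1) - (b + 1) * (x : ℂ) ^ 2 + (m : ℂ) * Complex.I * x) * unitPoint x ^ (-m)

lemma one_add_sq_pos (x : ℝ) : 0 < 1 + x ^ 2 := by positivity

lemma ofReal_one_add_sq_ne_zero (x : ℝ) : ((1 + x ^ 2 : ℝ) : ℂ) ≠ 0 :=
  Complex.ofReal_ne_zero.2 (one_add_sq_pos x).ne'

lemma ofReal_one_add_sq_mem_slitPlane (x : ℝ) : ((1 + x ^ 2 : ℝ) : ℂ) ∈ Complex.slitPlane :=
  Complex.ofReal_mem_slitPlane.2 (one_add_sq_pos x)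

lemma sqrt_one_add_sq_ne_zero (x : ℝ) : ((Real.sqrt (1 + x ^ 2) : ℝ) : ℂ) ≠ 0 :=
  Complex.ofReal_ne_zero.2 (Real.sqrt_pos.2 (one_add_sq_pos x)).ne'

lemma sqrt_one_add_sq_sq (x : ℝ) :
    ((Real.sqrt (1 + x ^ 2) : ℝ) : ℂ) ^ 2 = 1 + (x : ℂ) ^ 2 := by
  rw [← Complex.ofReal_pow, Real.sq_sqrt (one_add_sq_pos x).le]
  push_cast
  rfl

lemma unitPoint_mul_conj (x : ℝ) :
    unitPoint x * ((1 - (x : ℂ) * Complex.I) / ((Real.sqrt (1 + x ^ 2) : ℝ) : ℂ)) = 1 := by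
  have h := sqrt_one_add_sq_ne_zero x
  rw [unitPoint, div_mul_div_comm, ← sq, sqrt_one_add_sq_sq, div_eq_one_iff_eq]
  · linear_combination -(x : ℂ) ^ 2 * Complex.I_sq
  · rw [← sqrt_one_add_sq_sq]
    exact pow_ne_zero _ h

lemma unitPoint_ne_zero (x : ℝ) : unitPoint x ≠ 0 :=
  left_ne_zero_of_mul_eq_one (unitPoint_mul_conj x)

lemma norm_unitPoint (x : ℝ) : ‖unitPoint x‖ = 1 := by
  have h : ‖1 + (x : ℂ) * Complex.I‖ = Real.sqrt (1 + x ^ 2) := by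
    simpa using Complex.norm_add_mul_I 1 x
  rw [unitPoint, norm_div, h, Complex.norm_real, Real.norm_of_nonneg (Real.sqrt_nonneg _),
    div_self (Real.sqrt_pos.2 (one_add_sq_pos x)).ne']

lemma norm_unitPoint_zpow (x : ℝ) (m : ℤ) : ‖unitPoint x ^ m‖ = 1 := by
  rw [norm_zpow, norm_unitPoint, one_zpow]

lemma hasDerivAt_unitPoint (x : ℝ) :
    HasDerivAt unitPoint (Complex.I * unitPoint x / (1 + (x : ℂ) ^ 2)) x := by
  have hs := sqrt_one_add_sq_ne_zero x
  have hsq := sqrt_one_add_sq_sq x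
  have ht : (1 + (x : ℂ) ^ 2) ≠ 0 := hsq ▸ pow_ne_zero _ hs
  have h₁ : HasDerivAt (fun y : ℝ => 1 + (y : ℂ) * Complex.I) Complex.I x := by
    simpa using ((Complex.ofRealCLM.hasDerivAt (x := x)).mul_const Complex.I).const_add 1
  have h₂ : HasDerivAt (fun y : ℝ => 1 + y ^ 2) (2 * x) x := by
    simpa using (hasDerivAt_pow 2 x).const_add 1
  have h₃ := (h₂.sqrt (one_add_sq_pos x).ne').ofReal_comp
  refine (h₁.div h₃ hs).congr_deriv ?_
  simp only [unitPoint, ← hsq]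
  push_cast
  field_simp
  rw [hsq]
  linear_combination (-(x : ℂ)) * Complex.I_sq

lemma hasDerivAt_unitPoint_zpow (m : ℤ) (x : ℝ) :
    HasDerivAt (fun y => unitPoint y ^ (-m))
      (-(m : ℂ) * Complex.I * unitPoint x ^ (-m) / (1 + (x : ℂ) ^ 2)) x := by
  have h := (hasDerivAt_zpow (-m) _ (Or.inl (unitPoint_ne_zero x))).comp x (hasDerivAt_unitPoint x)
  refine h.congr_deriv ?_
  rw [zpow_sub_one₀ (unitPoint_ne_zero x)]
  have := unitPoint_ne_zero x
  push_cast
  field_simp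

lemma hasDerivAt_betaPrimitive (m : ℤ) {a b : ℂ} {x : ℝ} (hx : 0 < x) :
    HasDerivAt (betaPrimitive m a b)
      (b * (1 + b) * betaKernel m a b x -
        (4 + 3 * a + 5 * b + 2 * a * b + 2 * b ^ 2 - (m : ℂ) ^ 2) * betaKernel m a (b + 2) x +
        (2 + a + b - (m : ℂ)) * (2 + a + b + (m : ℂ)) * betaKernel m a (b + 4) x) x := by
  have hx₀ : (x : ℂ) ≠ 0 := Complex.ofReal_ne_zero.2 hx.ne'
  have ht := ofReal_one_add_sq_ne_zero x
  have hid : HasDerivAt (fun y : ℝ => (y : ℂ)) 1 x := Complex.ofRealCLM.hasDerivAt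
  have h₁ := ((hasDerivAt_id (x : ℂ)).cpow_const (c := a)
    (Complex.ofReal_mem_slitPlane.2 hx)).comp x hid
  have h₂ : HasDerivAt (fun y : ℝ => ((1 + y ^ 2 : ℝ) : ℂ)) (2 * x) x := by
    simpa using ((hasDerivAt_pow 2 x).const_add 1).ofReal_comp
  have h₃ := ((hasDerivAt_id ((1 + x ^ 2 : ℝ) : ℂ)).cpow_const (c := -(a + b) / 2 - 1)
    (ofReal_one_add_sq_mem_slitPlane x)).comp x h₂
  have h₄ := ((hid.pow 2).const_mul (b + 1)).const_sub (a + 1) |>.add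
    (hid.const_mul ((m : ℂ) * Complex.I))
  have h := ((h₁.mul h₃).mul h₄).mul (hasDerivAt_unitPoint_zpow m x)
  refine h.congr_deriv ?_
  have e₂ : -(a + (b + 2)) / 2 = -(a + b) / 2 - 1 := by ring
  have e₄ : -(a + (b + 4)) / 2 = -(a + b) / 2 - 1 - 1 := by ring
  simp only [betaKernel, e₂, e₄, Complex.cpow_sub _ _ ht, Complex.cpow_sub _ _ hx₀,
    Complex.cpow_one, Pi.mul_apply, Pi.add_apply, Pi.pow_apply, id, Function.comp_apply]
  generalize ((1 + x ^ 2 : ℝ) : ℂ) ^ (-(a + b) / 2) = T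
  generalize unitPoint x ^ (-m) = g
  generalize (x : ℂ) ^ a = X
  push_cast at ht ⊢
  field_simp
  ring_nf
  simp only [Complex.I_sq]
  ring

lemma continuous_unitPoint_zpow (m : ℤ) : Continuous fun x => unitPoint x ^ m :=
  continuous_iff_continuousAt.2 fun x =>
    (hasDerivAt_unitPoint x).continuousAt.zpow₀ m (Or.inl (unitPoint_ne_zero x))

lemma continuous_one_add_sq_cpow (c : ℂ) :
    Continuous fun x : ℝ => ((1 + x ^ 2 : ℝ) : ℂ) ^ c :=
  Continuous.cpow (by fun_prop) continuous_const ofReal_one_add_sq_mem_slitPlane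

lemma continuousOn_betaKernel (m : ℤ) (a b : ℂ) :
    ContinuousOn (betaKernel m a b) (Set.Ioi 0) := by
  refine ContinuousOn.mul (ContinuousOn.mul ?_ (continuous_one_add_sq_cpow _).continuousOn)
    (continuous_unitPoint_zpow _).continuousOn
  exact ContinuousOn.cpow Complex.continuous_ofReal.continuousOn continuousOn_const
    fun x hx => Complex.ofReal_mem_slitPlane.2 hx

lemma norm_betaKernel (m : ℤ) (a b : ℂ) {x : ℝ} (hx : 0 < x) :
    ‖betaKernel m a b x‖ = x ^ (a.re - 1) * (1 + x ^ 2) ^ (-(a.re + b.re) / 2) := by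
  rw [betaKernel, norm_mul, norm_mul, norm_unitPoint_zpow, mul_one,
    Complex.norm_cpow_eq_rpow_re_of_pos hx, Complex.norm_cpow_eq_rpow_re_of_pos (one_add_sq_pos x)]
  simp

lemma integrableOn_betaKernel (m : ℤ) {a b : ℂ} (ha : 0 < a.re) (hb : 0 < b.re) :
    IntegrableOn (betaKernel m a b) (Set.Ioi 0) := by
  have hmeas := (continuousOn_betaKernel m a b).aestronglyMeasurable measurableSet_Ioi
    (μ := volume)
  rw [← Set.Ioc_union_Ioi_eq_Ioi zero_le_one, integrableOn_union]
  constructor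
  · have hint : IntegrableOn (fun x : ℝ => x ^ (a.re - 1)) (Set.Ioc 0 1) :=
      (intervalIntegrable_iff_integrableOn_Ioc_of_le zero_le_one).1
        (intervalIntegral.intervalIntegrable_rpow' (by linarith))
    refine hint.mono' (hmeas.mono_set Set.Ioc_subset_Ioi_self) ?_
    refine (ae_restrict_iff' measurableSet_Ioc).2 (.of_forall fun x hx => ?_)
    rw [norm_betaKernel m a b hx.1]
    refine mul_le_of_le_one_right (Real.rpow_nonneg hx.1.le _) ?_
    exact Real.rpow_le_one_of_one_le_of_nonpos (by nlinarith [sq_nonneg x]) (by linarith)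
  · refine (integrableOn_Ioi_rpow_of_lt (a := -b.re - 1) (by linarith) zero_lt_one).mono'
      (hmeas.mono_set (Set.Ioi_subset_Ioi zero_le_one)) ?_
    refine (ae_restrict_iff' measurableSet_Ioi).2 (.of_forall fun x hx => ?_)
    have hx₀ : 0 < x := zero_lt_one.trans hx
    rw [norm_betaKernel m a b hx₀]
    calc x ^ (a.re - 1) * (1 + x ^ 2) ^ (-(a.re + b.re) / 2)
        ≤ x ^ (a.re - 1) * (x ^ 2) ^ (-(a.re + b.re) / 2) := by
          gcongr ?_ * ?_
          exact Real.rpow_le_rpow_of_nonpos (by positivity) (by linarith) (by linarith)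
      _ = x ^ (-b.re - 1) := by
          rw [← Real.rpow_natCast, ← Real.rpow_mul hx₀.le, ← Real.rpow_add hx₀]
          congr 1
          push_cast
          ring

lemma continuousAt_betaPrimitive_zero (m : ℤ) {a : ℂ} (b : ℂ) (ha : 0 < a.re) :
    ContinuousAt (betaPrimitive m a b) 0 := by
  refine ContinuousAt.mul (ContinuousAt.mul (ContinuousAt.mul ?_
    (continuous_one_add_sq_cpow _).continuousAt) (by fun_prop))
    (continuous_unitPoint_zpow _).continuousAt
  exact Complex.continuousAt_ofReal_cpow_const 0 a (Or.inl ha)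

lemma betaPrimitive_zero (m : ℤ) {a : ℂ} (b : ℂ) (ha : 0 < a.re) :
    betaPrimitive m a b 0 = 0 := by
  have : a ≠ 0 := fun h => by simp [h] at ha
  simp [betaPrimitive, Complex.zero_cpow this]

lemma norm_betaPrimitive_le (m : ℤ) {a b : ℂ} (ha : 0 < a.re) (hb : 0 < b.re) {x : ℝ}
    (hx : 1 ≤ x) :
    ‖betaPrimitive m a b x‖ ≤ (‖a + 1‖ + ‖b + 1‖ + ‖(m : ℂ)‖) * x ^ (-b.re) := by
  have hx₀ : 0 < x := zero_lt_one.trans_le hx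
  have hpoly : ‖(a + 1) - (b + 1) * (x : ℂ) ^ 2 + (m : ℂ) * Complex.I * x‖ ≤
      (‖a + 1‖ + ‖b + 1‖ + ‖(m : ℂ)‖) * x ^ 2 := by
    refine (norm_add_le _ _).trans ((add_le_add_left (norm_sub_le _ _) _).trans ?_)
    simp only [norm_mul, norm_pow, Complex.norm_real, Complex.norm_I, mul_one,
      Real.norm_of_nonneg hx₀.le]
    have h₁ : 1 ≤ x ^ 2 := one_le_pow₀ hx
    have h₂ : x ≤ x ^ 2 := by nlinarith
    nlinarith [mul_le_mul_of_nonneg_left h₁ (norm_nonneg (a + 1)),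
      mul_le_mul_of_nonneg_left h₂ (norm_nonneg (m : ℂ))]
  have hpow : (1 + x ^ 2) ^ (-(a.re + b.re) / 2 - 1) ≤ (x ^ 2) ^ (-(a.re + b.re) / 2 - 1) :=
    Real.rpow_le_rpow_of_nonpos (by positivity) (by linarith) (by linarith)
  rw [betaPrimitive, norm_mul, norm_mul, norm_mul, norm_unitPoint_zpow, mul_one,
    Complex.norm_cpow_eq_rpow_re_of_pos hx₀, Complex.norm_cpow_eq_rpow_re_of_pos (one_add_sq_pos x)]
  have hre : (-(a + b) / 2 - 1).re = -(a.re + b.re) / 2 - 1 := by simp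
  rw [hre]
  calc x ^ a.re * (1 + x ^ 2) ^ (-(a.re + b.re) / 2 - 1) *
        ‖(a + 1) - (b + 1) * (x : ℂ) ^ 2 + (m : ℂ) * Complex.I * x‖
      ≤ x ^ a.re * (x ^ 2) ^ (-(a.re + b.re) / 2 - 1) *
        ((‖a + 1‖ + ‖b + 1‖ + ‖(m : ℂ)‖) * x ^ 2) := by gcongr
    _ = (‖a + 1‖ + ‖b + 1‖ + ‖(m : ℂ)‖) *
        (x ^ a.re * (x ^ 2) ^ (-(a.re + b.re) / 2 - 1) * x ^ 2) := by ring
    _ = (‖a + 1‖ + ‖b + 1‖ + ‖(m : ℂ)‖) * x ^ (-b.re) := by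
        congr 1
        rw [← Real.rpow_natCast, ← Real.rpow_mul hx₀.le, ← Real.rpow_add hx₀,
          ← Real.rpow_add hx₀]
        congr 1
        push_cast
        ring

lemma tendsto_betaPrimitive_atTop (m : ℤ) {a b : ℂ} (ha : 0 < a.re) (hb : 0 < b.re) :
    Filter.Tendsto (betaPrimitive m a b) Filter.atTop (nhds 0) := by
  refine squeeze_zero_norm' (Filter.eventually_atTop.2
    ⟨1, fun x hx => norm_betaPrimitive_le m ha hb hx⟩) ?_
  simpa using (tendsto_rpow_neg_atTop hb).const_mul (‖a + 1‖ + ‖b + 1‖ + ‖(m : ℂ)‖)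

lemma integral_betaKernel_recursion (m : ℤ) {a b : ℂ} (ha : 0 < a.re) (hb : 0 < b.re) :
    b * (1 + b) * (∫ x in Set.Ioi 0, betaKernel m a b x) -
      (4 + 3 * a + 5 * b + 2 * a * b + 2 * b ^ 2 - (m : ℂ) ^ 2) *
        (∫ x in Set.Ioi 0, betaKernel m a (b + 2) x) +
      (2 + a + b - (m : ℂ)) * (2 + a + b + (m : ℂ)) *
        (∫ x in Set.Ioi 0, betaKernel m a (b + 4) x) = 0 := by
  have i₀ := (integrableOn_betaKernel m ha hb).const_mul (b * (1 + b))
  have i₂ := (integrableOn_betaKernel m ha (b := b + 2) (by simp; linarith)).const_mul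
    (4 + 3 * a + 5 * b + 2 * a * b + 2 * b ^ 2 - (m : ℂ) ^ 2)
  have i₄ := (integrableOn_betaKernel m ha (b := b + 4) (by simp; linarith)).const_mul
    ((2 + a + b - (m : ℂ)) * (2 + a + b + (m : ℂ)))
  have h := integral_Ioi_of_hasDerivAt_of_tendsto
    (continuousAt_betaPrimitive_zero m b ha).continuousWithinAt
    (fun x hx => hasDerivAt_betaPrimitive m hx) ((i₀.sub i₂).add i₄)
    (tendsto_betaPrimitive_atTop m ha hb)
  rw [betaPrimitive_zero m b ha, sub_zero] at h
  rw [← integral_const_mul, ← integral_const_mul, ← integral_const_mul, ← integral_sub i₀ i₂]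
  exact (integral_add (i₀.sub i₂) i₄).symm.trans h

lemma Bfun_eq_integral_betaKernel (ε : ℝ) (m : ℤ) {a b : ℂ} (ha : 0 < a.re) (hb : 0 < b.re) :
    Bfun ε m a b = (∫ x in Set.Ioi 0, betaKernel m a b x) +
      ε * ∫ x in Set.Ioi 0, betaKernel (-m) a b x := by
  rw [← integral_const_mul, ← integral_add (integrableOn_betaKernel m ha hb)
    ((integrableOn_betaKernel (-m) ha hb).const_mul _), Bfun]
  congr 1 with x
  rw [betaKernel, betaKernel, ← inv_zpow' (unitPoint x) (-m),
    inv_eq_of_mul_eq_one_right (unitPoint_mul_conj x), unitPoint]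
  ring

/-- The recursion formula in `b` for `ℬ_{ε,m}(a,b)`. -/
theorem stmt9 (ε : ℝ) (hε : ε = 1 ∨ ε = -1) (m : ℤ) (a b : ℂ)
    (ha : 0 < a.re) (hb : 0 < b.re) :
    Bfun ε m a b =
      ((4 + 3 * a + 5 * b + 2 * a * b + 2 * b ^ 2 - (m : ℂ) ^ 2) / (b * (1 + b))) *
        Bfun ε m a (b + 2) -
      ((2 + a + b - (m : ℂ)) * (2 + a + b + (m : ℂ)) / (b * (1 + b))) *
        Bfun ε m a (b + 4) := by
  have hb₀ : b ≠ 0 := fun h => by simp [h] at hb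
  have hb₁ : 1 + b ≠ 0 := fun h => by
    have := congrArg Complex.re h
    simp at this
    linarith
  rw [Bfun_eq_integral_betaKernel ε m ha hb,
    Bfun_eq_integral_betaKernel ε m ha (b := b + 2) (by simp; linarith),
    Bfun_eq_integral_betaKernel ε m ha (b := b + 4) (by simp; linarith)]
  have h₁ := integral_betaKernel_recursion m ha hb
  have h₂ := integral_betaKernel_recursion (-m) ha hb
  push_cast at h₂
  field_simp
  linear_combination h₁ + ε * h₂
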